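/- arXiv:1309.3807 — 2 statements merged into one kernel-verified Lean document; each statement's English description precedes it below -/
import Mathlib

section
/- Let k be an algebraically closed field of characteristic 2, let τ₁ = (1 2)(3 6)(4 7) and τ₂ = (1 6 7 5 4 3 2) be permutations of {1,…,7}, and let H = ⟨τ₁, τ₂⟩ (a subgroup of S₇ isomorphic to the dihedral group of order 14) act linearly on k⁷ by permuting coordinates: (g·v)_i = v_{g⁻¹(i)}. Then k⁷ is a semisimple H-module; that is, every H-invariant subspace of k⁷ has an H-invariant complement. -/
/-- The permutation τ₁ = (1 2)(3 6)(4 7) of {1, …, 7}, realized in `Equiv.Perm (Fin 7)`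
(the label 7 is represented by `(7 : Fin 7) = 0`). -/
def tau1 : Equiv.Perm (Fin 7) :=
  Equiv.swap 1 2 * Equiv.swap 3 6 * Equiv.swap 4 7

/-- The permutation τ₂ = (1 6 7 5 4 3 2) of {1, …, 7}. -/
def tau2 : Equiv.Perm (Fin 7) :=
  ([1, 6, 7, 5, 4, 3, 2] : List (Fin 7)).formPerm

/-- Over an algebraically closed field k of characteristic 2, the permutation module k⁷ of
H = ⟨τ₁, τ₂⟩ ≅ D₁₄ (acting by (g·v)ᵢ = v_{g⁻¹(i)}) is semisimple: every H-invariant subspace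
of k⁷ has an H-invariant complement. -/
theorem stmt11 (k : Type*) [Field k] [IsAlgClosed k] [CharP k 2] :
    ∀ U : Submodule k (Fin 7 → k),
      (∀ g ∈ Subgroup.closure {tau1, tau2}, ∀ v ∈ U, (fun i => v (g⁻¹ i)) ∈ U) →
      ∃ W : Submodule k (Fin 7 → k),
        (∀ g ∈ Subgroup.closure {tau1, tau2}, ∀ v ∈ W, (fun i => v (g⁻¹ i)) ∈ W) ∧
        IsCompl U W := by
  intro U hU
  let B : LinearMap.BilinForm k (Fin 7 → k) :=
    LinearMap.mk₂ k (fun v w => ∑ i, v i * w i)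
      (by intros; simp [add_mul, Finset.sum_add_distrib])
      (by intros; simp [Finset.mul_sum, mul_assoc])
      (by intros; simp [mul_add, Finset.sum_add_distrib])
      (by intros; simp [Finset.mul_sum, mul_left_comm])
  have hB : ∀ v w, B v w = ∑ i, v i * w i := fun v w => rfl
  have hsymm : B.IsSymm := ⟨fun v w => by simp [hB, mul_comm]⟩
  have hrefl : B.IsRefl := hsymm.isRefl
  have hnd : B.Nondegenerate := by
    refine (hrefl.nondegenerate_iff_separatingLeft).2 ?_
    intro v hv
    funext i
    have := hv (Pi.single i 1)
    simpa [hB, Pi.single_apply] using this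
  have hW : ∀ g ∈ Subgroup.closure {tau1, tau2}, ∀ v ∈ B.orthogonal U,
      (fun i => v (g⁻¹ i)) ∈ B.orthogonal U := by
    intro g hg v hv
    rw [LinearMap.BilinForm.mem_orthogonal_iff] at hv ⊢
    intro u hu
    have h1 := hv _ (hU g⁻¹ (inv_mem hg) u hu)
    change B _ _ = 0 at h1
    change B _ _ = 0
    rw [hB] at h1 ⊢
    rw [← h1, ← Equiv.sum_comp g]
    simp
  refine ⟨B.orthogonal U, hW, ?_⟩
  rw [LinearMap.BilinForm.isCompl_orthogonal_iff_disjoint hrefl, Submodule.disjoint_def]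
  have m1 : tau1 ∈ Subgroup.closure {tau1, tau2} := Subgroup.subset_closure (by simp)
  have m2 : tau2 ∈ Subgroup.closure {tau1, tau2} := Subgroup.subset_closure (by simp)
  have key : ∀ v ∈ U, v ∈ B.orthogonal U → v 5 = 0 := by
    intro v hv hv'
    rw [LinearMap.BilinForm.mem_orthogonal_iff] at hv'
    have h := hv' _ (hU _ m1 v hv)
    change B _ _ = 0 at h
    rw [hB] at h
    have e0 : tau1⁻¹ 0 = 4 := by decide
    have e1 : tau1⁻¹ 1 = 2 := by decide
    have e2 : tau1⁻¹ 2 = 1 := by decide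
    have e3 : tau1⁻¹ 3 = 6 := by decide
    have e4 : tau1⁻¹ 4 = 0 := by decide
    have e5 : tau1⁻¹ 5 = 5 := by decide
    have e6 : tau1⁻¹ 6 = 3 := by decide
    simp only [Fin.sum_univ_seven, e0, e1, e2, e3, e4, e5, e6] at h
    have h2 : (2 : k) = 0 := CharTwo.two_eq_zero
    have : v 5 * v 5 = 0 := by
      linear_combination h - (v 0 * v 4 + v 1 * v 2 + v 3 * v 6) * h2
    exact mul_self_eq_zero.1 this
  intro v hv hv'
  have key2 : ∀ j : ℕ, v ((tau2 ^ j) 5) = 0 := by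
    intro j
    have hm := inv_mem (pow_mem m2 j)
    simpa using key _ (hU _ hm v hv) (hW _ hm v hv')
  funext i
  have : ∀ i : Fin 7, ∃ j : Fin 7, (tau2 ^ (j : ℕ)) 5 = i := by decide
  obtain ⟨j, rfl⟩ := this i
  exact key2 j
end

section
/- Let k be an algebraically closed field of characteristic 2, let τ₁ = (1 2)(3 6)(4 7) and τ₂ = (1 6 7 5 4 3 2) be permutations of {1,…,7}, and let H = ⟨τ₁, τ₂⟩ act linearly on V = k⁷ by permuting coordinates. Then V decomposes as an internal direct sum V = T ⊕ U₁ ⊕ U₂ ⊕ U₃ of H-invariant subspaces, where T is the 1-dimensional subspace spanned by the all-ones vector (1,1,1,1,1,1,1), on which H acts trivially, and each Uᵢ is a 2-dimensional H-invariant subspace that is simple (i.e. Uᵢ has no H-invariant subspace other than 0 and Uᵢ). -/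
/-- The 1-dimensional subspace of k⁷ spanned by the all-ones vector. -/
def allOnes (k : Type*) [Field k] : Submodule k (Fin 7 → k) :=
  Submodule.span k {(fun _ => 1 : Fin 7 → k)}

/-- Position along the 7-cycle. -/
def pos7 : Fin 7 → ℕ := ![6, 4, 3, 2, 1, 0, 5]

/-- The vector attached to a root of unity. -/
def ev {k : Type*} [Field k] (z : k) : Fin 7 → k := fun i => z ^ pos7 i

/-- The two-dimensional piece. -/
def UU {k : Type*} [Field k] (z : k) : Submodule k (Fin 7 → k) :=
  Submodule.span k {ev z, ev (z ^ 6)}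

lemma pos_tau1 : ∀ i, (6 * pos7 i) % 7 = pos7 (tau1 i) := by decide
lemma pos_tau1' : ∀ i, (6 * pos7 i) % 7 = pos7 (tau1⁻¹ i) := by decide
lemma pos_tau2 : ∀ i, (1 + pos7 i) % 7 = pos7 (tau2 i) := by decide
lemma pos_tau2' : ∀ i, (6 + pos7 i) % 7 = pos7 (tau2⁻¹ i) := by decide

lemma pow_mod7 {k : Type*} [Field k] {z : k} (hz : z ^ 7 = 1) (n : ℕ) : z ^ (n % 7) = z ^ n :=
  (pow_eq_pow_mod n hz).symm

section
variable {k : Type*} [Field k] {z : k} (hz : z ^ 7 = 1)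

lemma ev_tau1 (hz : z ^ 7 = 1) : (fun i => ev z (tau1 i)) = ev (z ^ 6) := by
  funext i; simp only [ev]; rw [← pos_tau1, pow_mod7 hz, pow_mul]
lemma ev_tau1' (hz : z ^ 7 = 1) : (fun i => ev z (tau1⁻¹ i)) = ev (z ^ 6) := by
  funext i; simp only [ev]; rw [← pos_tau1', pow_mod7 hz, pow_mul]
lemma ev_tau2 (hz : z ^ 7 = 1) : (fun i => ev z (tau2 i)) = z • ev z := by
  funext i; simp only [ev, Pi.smul_apply, smul_eq_mul]; rw [← pos_tau2, pow_mod7 hz, pow_add, pow_one]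
lemma ev_tau2' (hz : z ^ 7 = 1) : (fun i => ev z (tau2⁻¹ i)) = z ^ 6 • ev z := by
  funext i; simp only [ev, Pi.smul_apply, smul_eq_mul]; rw [← pos_tau2', pow_mod7 hz, pow_add]

lemma z66 (hz : z ^ 7 = 1) : (z ^ 6) ^ 6 = z := by
  rw [← pow_mul, ← pow_mod7 hz]; simp
lemma z67 (hz : z ^ 7 = 1) : (z ^ 6) ^ 7 = 1 := by
  rw [← pow_mul, ← pow_mod7 hz]; simp

lemma ev_mem1 (z : k) : ev z ∈ UU z := Submodule.subset_span (by simp)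
lemma ev_mem2 (z : k) : ev (z ^ 6) ∈ UU z := Submodule.subset_span (by simp)

lemma UU_gen (f : Fin 7 → Fin 7) (h1 : (fun i => ev z (f i)) ∈ UU z)
    (h2 : (fun i => ev (z ^ 6) (f i)) ∈ UU z) : ∀ v ∈ UU z, (fun i => v (f i)) ∈ UU z := by
  intro v hv
  have : UU z ≤ (UU z).comap (LinearMap.funLeft k k f) := by
    conv_lhs => rw [UU]
    rw [Submodule.span_le]
    rintro x (rfl | rfl)
    · exact h1
    · exact h2
  exact this hv

lemma UU_inv (hz : z ^ 7 = 1) : ∀ g ∈ Subgroup.closure {tau1, tau2}, ∀ v ∈ UU z,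
    (fun i => v (g⁻¹ i)) ∈ UU z := by
  intro g hg
  induction hg using Subgroup.closure_induction'' with
  | mem x hx =>
    rcases hx with rfl | rfl
    · apply UU_gen
      · rw [ev_tau1' hz]; exact ev_mem2 z
      · rw [ev_tau1' (z67 hz), z66 hz]; exact ev_mem1 z
    · apply UU_gen
      · rw [ev_tau2' hz]; exact Submodule.smul_mem _ _ (ev_mem1 z)
      · rw [ev_tau2' (z67 hz)]; exact Submodule.smul_mem _ _ (ev_mem2 z)
  | inv_mem x hx =>
    simp only [inv_inv]
    rcases hx with rfl | rfl
    · apply UU_gen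
      · rw [ev_tau1 hz]; exact ev_mem2 z
      · rw [ev_tau1 (z67 hz), z66 hz]; exact ev_mem1 z
    · apply UU_gen
      · rw [ev_tau2 hz]; exact Submodule.smul_mem _ _ (ev_mem1 z)
      · rw [ev_tau2 (z67 hz)]; exact Submodule.smul_mem _ _ (ev_mem2 z)
  | one => intro v hv; simpa using hv
  | mul x y _ _ hx hy =>
    intro v hv
    have := hx _ (hy v hv)
    simpa [mul_inv_rev] using this

lemma UU_simple (hz : z ^ 7 = 1) (hne : z ^ 6 ≠ z) (W : Submodule k (Fin 7 → k)) (hW : W ≤ UU z)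
    (hinv : ∀ g ∈ Subgroup.closure {tau1, tau2}, ∀ v ∈ W, (fun i => v (g⁻¹ i)) ∈ W) :
    W = ⊥ ∨ W = UU z := by
  by_cases hb : W = ⊥
  · exact Or.inl hb
  right
  apply le_antisymm hW
  have h1 : ∀ v ∈ W, (fun i => v (tau1⁻¹ i)) ∈ W :=
    hinv tau1 (Subgroup.subset_closure (by simp))
  have h2 : ∀ v ∈ W, (fun i => v (tau2⁻¹ i)) ∈ W :=
    hinv tau2 (Subgroup.subset_closure (by simp))
  obtain ⟨v, hv, hv0⟩ := Submodule.exists_mem_ne_zero_of_ne_bot hb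
  have hsw1 : ev z ∈ W → ev (z ^ 6) ∈ W := fun h => by
    have := h1 _ h; rwa [ev_tau1' hz] at this
  have hsw2 : ev (z ^ 6) ∈ W → ev z ∈ W := fun h => by
    have := h1 _ h; rwa [ev_tau1' (z67 hz), z66 hz] at this
  have key : ev z ∈ W := by
    obtain ⟨a, b, hab⟩ := Submodule.mem_span_pair.1 (hW hv)
    have hS : (fun i => v (tau2⁻¹ i)) = (a * z ^ 6) • ev z + (b * z) • ev (z ^ 6) := by
      have e1 := ev_tau2' hz
      have e2 := ev_tau2' (z67 hz)
      rw [z66 hz] at e2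
      rw [← hab, mul_smul, mul_smul, ← e1, ← e2]
      rfl
    have hm := h2 v hv
    rw [hS] at hm
    by_cases ha : a = 0
    · have hb0 : b ≠ 0 := by
        rintro rfl
        apply hv0; rw [← hab, ha]; simp
      apply hsw2
      rw [ha, zero_smul, zero_add] at hab
      rw [← hab] at hv
      exact (Submodule.smul_mem_iff _ hb0).1 hv
    · have hd := W.sub_mem hm (W.smul_mem z hv)
      have : (a * z ^ 6) • ev z + (b * z) • ev (z ^ 6) - z • v = (a * (z ^ 6 - z)) • ev z := by
        rw [← hab]; module
      rw [this] at hd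
      exact (Submodule.smul_mem_iff _ (mul_ne_zero ha (sub_ne_zero.2 hne))).1 hd
  rw [UU, Submodule.span_le]
  rintro x (rfl | rfl)
  · exact key
  · exact hsw1 key

lemma ev_li {w : k} (hw : IsPrimitiveRoot w 7) :
    LinearIndependent k (fun j : Fin 7 => ev (w ^ (j : ℕ))) := by
  apply Module.End.eigenvectors_linearIndependent' (LinearMap.funLeft k k tau2)
    (fun j : Fin 7 => w ^ (j : ℕ))
  · intro a b h
    exact Fin.ext (hw.pow_inj a.2 b.2 h)
  · intro j
    refine ⟨Module.End.mem_eigenspace_iff.2 (ev_tau2 ?_), ?_⟩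
    · rw [← pow_mul, mul_comm, pow_mul, hw.pow_eq_one, one_pow]
    · intro h
      have := congrFun h 5
      simp [ev, pos7] at this

end

lemma iSupIndep_of_color {k V ι κ : Type*} [Field k] [AddCommGroup V] [Module k V] {b : ι → V}
    (hb : LinearIndependent k b) (c : ι → κ) :
    iSupIndep (fun i => Submodule.span k (b '' {j | c j = i})) := by
  intro i
  simp only [← Submodule.span_iUnion, ← Set.image_iUnion]
  apply hb.disjoint_span_image
  rw [Set.disjoint_left]
  rintro j hj hj'
  simp only [Set.mem_iUnion, Set.mem_ofPred_eq] at hj hj'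
  obtain ⟨a, ha, h⟩ := hj'
  exact ha (h ▸ hj)

/-- Over an algebraically closed field k of characteristic 2, the permutation module V = k⁷ of
H = ⟨τ₁, τ₂⟩ (acting by (g·v)ᵢ = v_{g⁻¹(i)}) decomposes as an internal direct sum
V = T ⊕ U₁ ⊕ U₂ ⊕ U₃ of H-invariant subspaces, where T is the 1-dimensional span of the
all-ones vector, on which H acts trivially, and each Uᵢ is a 2-dimensional H-invariant
subspace that is simple (it has no H-invariant subspace other than 0 and itself). -/
theorem stmt12 (k : Type*) [Field k] [IsAlgClosed k] [CharP k 2] :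
    ∃ U₁ U₂ U₃ : Submodule k (Fin 7 → k),
      Module.finrank k (allOnes k) = 1 ∧
      (∀ g ∈ Subgroup.closure {tau1, tau2}, ∀ v ∈ allOnes k, (fun i => v (g⁻¹ i)) = v) ∧
      (∀ g ∈ Subgroup.closure {tau1, tau2}, ∀ v ∈ U₁, (fun i => v (g⁻¹ i)) ∈ U₁) ∧
      (∀ g ∈ Subgroup.closure {tau1, tau2}, ∀ v ∈ U₂, (fun i => v (g⁻¹ i)) ∈ U₂) ∧
      (∀ g ∈ Subgroup.closure {tau1, tau2}, ∀ v ∈ U₃, (fun i => v (g⁻¹ i)) ∈ U₃) ∧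
      Module.finrank k U₁ = 2 ∧ Module.finrank k U₂ = 2 ∧ Module.finrank k U₃ = 2 ∧
      (∀ W : Submodule k (Fin 7 → k), W ≤ U₁ →
        (∀ g ∈ Subgroup.closure {tau1, tau2}, ∀ v ∈ W, (fun i => v (g⁻¹ i)) ∈ W) →
        W = ⊥ ∨ W = U₁) ∧
      (∀ W : Submodule k (Fin 7 → k), W ≤ U₂ →
        (∀ g ∈ Subgroup.closure {tau1, tau2}, ∀ v ∈ W, (fun i => v (g⁻¹ i)) ∈ W) →
        W = ⊥ ∨ W = U₂) ∧
      (∀ W : Submodule k (Fin 7 → k), W ≤ U₃ →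
        (∀ g ∈ Subgroup.closure {tau1, tau2}, ∀ v ∈ W, (fun i => v (g⁻¹ i)) ∈ W) →
        W = ⊥ ∨ W = U₃) ∧
      iSupIndep (![allOnes k, U₁, U₂, U₃] : Fin 4 → Submodule k (Fin 7 → k)) ∧
      allOnes k ⊔ U₁ ⊔ U₂ ⊔ U₃ = ⊤ := by
  haveI : NeZero ((7 : ℕ) : k) := ⟨by
    intro h
    have := (CharP.cast_eq_zero_iff k 2 7).1 h
    omega⟩
  obtain ⟨w, hw⟩ := HasEnoughRootsOfUnity.exists_primitiveRoot k 7
  have hw7 : w ^ 7 = 1 := hw.pow_eq_one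
  have hp : ∀ m : ℕ, (w ^ m) ^ 7 = 1 := fun m => by
    rw [← pow_mul, mul_comm, pow_mul, hw7, one_pow]
  have hli := ev_li hw
  have hb6 : ∀ m n : ℕ, (6 * m) % 7 = n → (w ^ m) ^ 6 = w ^ n := fun m n h => by
    rw [← h, pow_mod7 hw7, mul_comm, pow_mul]
  have hne : ∀ m n : ℕ, m < 7 → n < 7 → m ≠ n → w ^ n ≠ w ^ m := fun m n h1 h2 h3 h =>
    h3 (hw.pow_inj h2 h1 h).symm
  have n1 : (w ^ 1) ^ 6 ≠ w ^ 1 := by rw [hb6 1 6 rfl]; exact hne 1 6 (by simp) (by simp) (by simp)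
  have n2 : (w ^ 2) ^ 6 ≠ w ^ 2 := by rw [hb6 2 5 rfl]; exact hne 2 5 (by simp) (by simp) (by simp)
  have n3 : (w ^ 3) ^ 6 ≠ w ^ 3 := by rw [hb6 3 4 rfl]; exact hne 3 4 (by simp) (by simp) (by simp)
  have hfr : ∀ a b : Fin 7, a ≠ b → (w ^ (a : ℕ)) ^ 6 = w ^ (b : ℕ) →
      Module.finrank k (UU (w ^ (a : ℕ))) = 2 := by
    intro a b hab h
    have hl : LinearIndependent k ((fun j : Fin 7 => ev (w ^ (j : ℕ))) ∘ ![a, b]) := by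
      apply hli.comp
      intro x y hxy
      fin_cases x <;> fin_cases y <;> simp_all
    have := finrank_span_eq_card hl
    have hr : Set.range ((fun j : Fin 7 => ev (w ^ (j : ℕ))) ∘ ![a, b])
        = {ev (w ^ (a : ℕ)), ev (w ^ (b : ℕ))} := by
      rw [Set.range_comp]; simp [Set.image_pair, Set.pair_comm]
    rw [hr] at this
    rw [UU, h, this]; simp
  have hone : (fun _ => 1 : Fin 7 → k) = ev (w ^ 0) := by
    funext i; simp [ev]
  have key : (![allOnes k, UU (w ^ 1), UU (w ^ 2), UU (w ^ 3)] : Fin 4 → Submodule k (Fin 7 → k))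
      = fun i => Submodule.span k ((fun j : Fin 7 => ev (w ^ (j : ℕ))) ''
        {j | (![0, 1, 2, 3, 3, 2, 1] : Fin 7 → Fin 4) j = i}) := by
    have s0 : {j | (![0, 1, 2, 3, 3, 2, 1] : Fin 7 → Fin 4) j = 0} = {0} := by
      ext j; revert j; decide
    have s1 : {j | (![0, 1, 2, 3, 3, 2, 1] : Fin 7 → Fin 4) j = 1} = {1, 6} := by
      ext j; revert j; decide
    have s2 : {j | (![0, 1, 2, 3, 3, 2, 1] : Fin 7 → Fin 4) j = 2} = {2, 5} := by
      ext j; revert j; decide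
    have s3 : {j | (![0, 1, 2, 3, 3, 2, 1] : Fin 7 → Fin 4) j = 3} = {3, 4} := by
      ext j; revert j; decide
    funext i
    fin_cases i
    · change allOnes k = Submodule.span k (_ '' {j | (![0, 1, 2, 3, 3, 2, 1] : Fin 7 → Fin 4) j = 0})
      rw [s0, Set.image_singleton, allOnes, hone]; rfl
    · change UU (w ^ 1) = Submodule.span k (_ '' {j | (![0, 1, 2, 3, 3, 2, 1] : Fin 7 → Fin 4) j = 1})
      rw [s1, Set.image_pair, UU, hb6 1 6 rfl]; rfl
    · change UU (w ^ 2) = Submodule.span k (_ '' {j | (![0, 1, 2, 3, 3, 2, 1] : Fin 7 → Fin 4) j = 2})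
      rw [s2, Set.image_pair, UU, hb6 2 5 rfl]; rfl
    · change UU (w ^ 3) = Submodule.span k (_ '' {j | (![0, 1, 2, 3, 3, 2, 1] : Fin 7 → Fin 4) j = 3})
      rw [s3, Set.image_pair, UU, hb6 3 4 rfl]; rfl
  refine ⟨UU (w ^ 1), UU (w ^ 2), UU (w ^ 3), ?_, ?_, UU_inv (hp 1), UU_inv (hp 2), UU_inv (hp 3),
    hfr 1 6 (by decide) (hb6 1 6 rfl), hfr 2 5 (by decide) (hb6 2 5 rfl),
    hfr 3 4 (by decide) (hb6 3 4 rfl), UU_simple (hp 1) n1, UU_simple (hp 2) n2,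
    UU_simple (hp 3) n3, ?_, ?_⟩
  · apply finrank_span_singleton
    intro h
    have := congrFun h 0
    simp at this
  · intro g _ v hv
    obtain ⟨a, rfl⟩ := Submodule.mem_span_singleton.1 hv
    rfl
  · rw [key]
    exact iSupIndep_of_color hli _
  · rw [eq_top_iff, ← hli.span_eq_top_of_card_eq_finrank (by simp), Submodule.span_le]
    rintro _ ⟨j, rfl⟩
    have a0 : ev (w ^ 0) ∈ allOnes k := by
      rw [← hone]; exact Submodule.mem_span_singleton_self _
    have l0 : allOnes k ≤ allOnes k ⊔ UU (w ^ 1) ⊔ UU (w ^ 2) ⊔ UU (w ^ 3) :=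
      le_sup_left.trans (le_sup_left.trans le_sup_left)
    have l1 : UU (w ^ 1) ≤ allOnes k ⊔ UU (w ^ 1) ⊔ UU (w ^ 2) ⊔ UU (w ^ 3) :=
      le_sup_right.trans (le_sup_left.trans le_sup_left)
    have l2 : UU (w ^ 2) ≤ allOnes k ⊔ UU (w ^ 1) ⊔ UU (w ^ 2) ⊔ UU (w ^ 3) :=
      le_sup_right.trans le_sup_left
    have l3 : UU (w ^ 3) ≤ allOnes k ⊔ UU (w ^ 1) ⊔ UU (w ^ 2) ⊔ UU (w ^ 3) := le_sup_right
    have a1 := l1 (ev_mem1 (w ^ 1))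
    have a2 := l2 (ev_mem1 (w ^ 2))
    have a3 := l3 (ev_mem1 (w ^ 3))
    have a6 := l1 (ev_mem2 (w ^ 1))
    have a5 := l2 (ev_mem2 (w ^ 2))
    have a4 := l3 (ev_mem2 (w ^ 3))
    rw [hb6 1 6 rfl] at a6
    rw [hb6 2 5 rfl] at a5
    rw [hb6 3 4 rfl] at a4
    fin_cases j
    · exact l0 a0
    · exact a1
    · exact a2
    · exact a3
    · exact a4
    · exact a5
    · exact a6
end
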